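/- arXiv:2006.04177 — 5 statements merged into one kernel-verified Lean document; each statement's English description precedes it below -/
import Mathlib

section
/- For every natural number n ≥ 1: n belongs to the lower Wythoff set L (i.e., n = ⌊i·φ⌋ for some integer i ≥ 1) if and only if there exists a finite set S of integers, each at least 3, containing no two consecutive integers, such that n − 1 = Σ_{k ∈ S} F_k. (Equivalently: the Zeckendorf representation of n − 1 ends in the digit 0.) -/
noncomputable def phi : ℝ := (1 + Real.sqrt 5) / 2

/-- The lower Wythoff set `L = {⌊i·φ⌋ : i ≥ 1}`. -/
def lowerWythoff : Set ℕ := {n | ∃ i : ℕ, 1 ≤ i ∧ n = ⌊(i : ℝ) * phi⌋₊}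

/-- The upper Wythoff set `U = {⌊i·φ²⌋ : i ≥ 1}`. -/
def upperWythoff : Set ℕ := {n | ∃ i : ℕ, 1 ≤ i ∧ n = ⌊(i : ℝ) * phi ^ 2⌋₊}

open Real in
/-- A sum of nonconsecutive powers of the golden conjugate `ψ` with exponents greater than `c`
lies strictly between `-ψ ^ c` and `-ψ ^ (c + 1)`. -/
theorem exists_sum_goldenConj_pow_eq (S : Finset ℕ) (c : ℕ) (hc : ∀ k ∈ S, c < k)
    (hS : ∀ k ∈ S, k + 1 ∉ S) :
    ∃ t : ℝ, -1 < t ∧ t < -goldenConj ∧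
      ∑ k ∈ S, goldenConj ^ k = goldenConj ^ c * t := by
  obtain ⟨d, hd⟩ : ∃ d, ∀ k ∈ S, k ≤ c + d :=
    ⟨S.sup id, fun k hk => (Finset.le_sup (f := id) hk).trans (Nat.le_add_left _ _)⟩
  have hneg := goldenConj_neg
  have hgt := neg_one_lt_goldenConj
  have hsq := goldenConj_sq
  induction d using Nat.strong_induction_on generalizing S c with
  | _ d ih =>
    rcases S.eq_empty_or_nonempty with rfl | ⟨a, ha⟩
    · exact ⟨0, by norm_num, by linarith, by simp⟩
    have had := hd a ha
    have hca := hc a ha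
    by_cases hmem : c + 1 ∈ S
    · have hlarge : ∀ k ∈ S.erase (c + 1), c + 2 < k := by
        intro k hk
        obtain ⟨hne, hkS⟩ := Finset.mem_erase.1 hk
        have h1 := hc k hkS
        have h2 : k ≠ c + 2 := fun h => hS _ hmem (h ▸ hkS)
        omega
      obtain ⟨t, ht1, ht2, ht⟩ := ih (d - 1) (by omega) (S.erase (c + 1)) (c + 2) hlarge
        (fun k hk h => hS k (Finset.mem_of_mem_erase hk) (Finset.mem_of_mem_erase h))
        (fun k hk => by have := hd k (Finset.mem_of_mem_erase hk); omega)
      refine ⟨goldenConj + goldenConj ^ 2 * t, by nlinarith, by nlinarith, ?_⟩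
      rw [← Finset.add_sum_erase S _ hmem, ht]
      ring
    · obtain ⟨t, ht1, ht2, ht⟩ := ih (d - 1) (by omega) S (c + 1)
        (fun k hk => by
          have h1 := hc k hk
          have h2 : k ≠ c + 1 := fun h => hmem (h ▸ hk)
          omega)
        hS (fun k hk => by have := hd k hk; omega)
      exact ⟨goldenConj * t, by nlinarith, by nlinarith, by rw [ht]; ring⟩

open Real in
theorem goldenConj_mul_sum_fib_add_sum_fib_pred (S : Finset ℕ) (hS : ∀ k ∈ S, 0 < k) :
    goldenConj * ((∑ k ∈ S, Nat.fib k : ℕ) : ℝ) + ((∑ k ∈ S, Nat.fib (k - 1) : ℕ) : ℝ) =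
      ∑ k ∈ S, goldenConj ^ k := by
  push_cast
  rw [Finset.mul_sum, ← Finset.sum_add_distrib]
  refine Finset.sum_congr rfl fun k hk => ?_
  obtain ⟨j, rfl⟩ := Nat.exists_eq_succ_of_ne_zero (hS k hk).ne'
  exact goldenConj_mul_fib_succ_add_fib j

theorem exists_finset_zeckendorf (m : ℕ) :
    ∃ S : Finset ℕ, (∀ k ∈ S, 2 ≤ k) ∧ (∀ k ∈ S, k + 1 ∉ S) ∧ m = ∑ k ∈ S, Nat.fib k := by
  have : IsTrans ℕ fun a b => b + 2 ≤ a := ⟨fun _ _ _ _ _ => by omega⟩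
  have h := m.isZeckendorfRep_zeckendorf
  rw [List.IsZeckendorfRep, List.isChain_iff_pairwise, List.pairwise_append] at h
  obtain ⟨hp, -, h2⟩ := h
  have hnodup : m.zeckendorf.Nodup := hp.imp fun hab => by omega
  refine ⟨m.zeckendorf.toFinset, fun k hk => ?_, fun k hk hk' => ?_, ?_⟩
  · simpa using h2 k (List.mem_toFinset.1 hk) 0 (by simp)
  · have hgap : m.zeckendorf.Pairwise fun a b => b + 2 ≤ a ∨ a + 2 ≤ b := hp.imp Or.inl
    have : Std.Symm fun a b : ℕ => b + 2 ≤ a ∨ a + 2 ≤ b := ⟨fun _ _ => Or.symm⟩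
    have := hgap.forall (List.mem_toFinset.1 hk) (List.mem_toFinset.1 hk')
      (by omega)
    omega
  · rw [List.sum_toFinset _ hnodup, Nat.sum_zeckendorf_fib]

open Real in
theorem succ_mem_lowerWythoff_iff (m : ℕ) :
    m + 1 ∈ lowerWythoff ↔
      ∃ i : ℕ, (m : ℝ) + 1 ≤ i * goldenRatio ∧ (i : ℝ) * goldenRatio < m + 2 := by
  have hfloor (i : ℕ) : m + 1 = ⌊(i : ℝ) * phi⌋₊ ↔
      (m : ℝ) + 1 ≤ i * goldenRatio ∧ (i : ℝ) * goldenRatio < m + 2 := by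
    change m + 1 = ⌊(i : ℝ) * goldenRatio⌋₊ ↔ _
    rw [eq_comm, Nat.floor_eq_iff (mul_nonneg i.cast_nonneg goldenRatio_pos.le)]
    push_cast
    rw [add_assoc (m : ℝ) 1 1, one_add_one_eq_two]
  refine exists_congr fun i => ?_
  rw [hfloor]
  refine and_iff_right_of_imp fun h => Nat.one_le_iff_ne_zero.2 ?_
  rintro rfl
  have := h.1
  rw [Nat.cast_zero, zero_mul] at this
  linarith [(m.cast_nonneg : (0 : ℝ) ≤ m)]

open Real in
theorem succ_sum_fib_mem_lowerWythoff {S : Finset ℕ} (h3 : ∀ k ∈ S, 3 ≤ k)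
    (hS : ∀ k ∈ S, k + 1 ∉ S) : ∑ k ∈ S, Nat.fib k + 1 ∈ lowerWythoff := by
  obtain ⟨t, ht1, ht2, ht⟩ := exists_sum_goldenConj_pow_eq S 2 h3 hS
  have hsum := goldenConj_mul_sum_fib_add_sum_fib_pred S fun k hk => by have := h3 k hk; omega
  rw [ht] at hsum
  rw [succ_mem_lowerWythoff_iff]
  refine ⟨∑ k ∈ S, Nat.fib (k - 1) + 1, ?_⟩
  rw [Nat.cast_add_one]
  generalize ((∑ k ∈ S, Nat.fib k : ℕ) : ℝ) = m at *
  generalize ((∑ k ∈ S, Nat.fib (k - 1) : ℕ) : ℝ) = s at *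
  have he : goldenRatio * s = m - goldenConj * t := by
    linear_combination goldenRatio * hsum + (goldenConj * t - m) * goldenRatio_mul_goldenConj
  have hφ := goldenRatio_add_goldenConj
  have hneg := goldenConj_neg
  have hgt := neg_one_lt_goldenConj
  have hsq := goldenConj_sq
  constructor <;> nlinarith

open Real in
theorem succ_sum_fib_notMem_lowerWythoff {S : Finset ℕ} (h2 : ∀ k ∈ S, 2 ≤ k)
    (hS : ∀ k ∈ S, k + 1 ∉ S) (hmem : 2 ∈ S) : ∑ k ∈ S, Nat.fib k + 1 ∉ lowerWythoff := by
  obtain ⟨t, ht1, ht2, ht⟩ := exists_sum_goldenConj_pow_eq (S.erase 2) 3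
    (fun k hk => by
      obtain ⟨hne, hkS⟩ := Finset.mem_erase.1 hk
      have h1 := h2 k hkS
      have h3 : k ≠ 2 + 1 := fun h => hS 2 hmem (h ▸ hkS)
      omega)
    fun k hk h => hS k (Finset.mem_of_mem_erase hk) (Finset.mem_of_mem_erase h)
  have hsum := goldenConj_mul_sum_fib_add_sum_fib_pred S fun k hk => by have := h2 k hk; omega
  rw [← Finset.add_sum_erase S (goldenConj ^ ·) hmem, ht] at hsum
  rw [succ_mem_lowerWythoff_iff]
  rintro ⟨i, hi1, hi2⟩
  have hi : i ≤ ∑ k ∈ S, Nat.fib (k - 1) ∨ ∑ k ∈ S, Nat.fib (k - 1) + 1 ≤ i := by omega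
  rw [← Nat.cast_le (α := ℝ), ← Nat.cast_le (α := ℝ), Nat.cast_add_one] at hi
  generalize ((∑ k ∈ S, Nat.fib k : ℕ) : ℝ) = m at *
  generalize ((∑ k ∈ S, Nat.fib (k - 1) : ℕ) : ℝ) = s at *
  have he : goldenRatio * s = m - (goldenConj + goldenConj ^ 2 * t) := by
    linear_combination goldenRatio * hsum +
      (goldenConj + goldenConj ^ 2 * t - m) * goldenRatio_mul_goldenConj
  have hφ := goldenRatio_add_goldenConj
  have hneg := goldenConj_neg
  have hgt := neg_one_lt_goldenConj
  have hsq := goldenConj_sq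
  rcases hi with hi | hi <;> nlinarith [mul_le_mul_of_nonneg_right hi goldenRatio_pos.le]

/-- `n ∈ L` iff the Zeckendorf representation of `n - 1` ends in digit 0,
i.e., `n - 1` is a sum of non-consecutive Fibonacci numbers with indices ≥ 3. -/
theorem lower_wythoff_iff_zeckendorf_ends_in_zero (n : ℕ) (hn : 1 ≤ n) :
    n ∈ lowerWythoff ↔
      ∃ S : Finset ℕ, (∀ k ∈ S, 3 ≤ k) ∧ (∀ k ∈ S, k + 1 ∉ S) ∧
        n - 1 = ∑ k ∈ S, Nat.fib k := by
  obtain ⟨m, rfl⟩ := Nat.exists_eq_add_of_le' hn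
  rw [Nat.add_sub_cancel]
  constructor
  · intro hL
    obtain ⟨S, h2, hS, rfl⟩ := exists_finset_zeckendorf m
    refine ⟨S, fun k hk => ?_, hS, rfl⟩
    have hk2 : k ≠ 2 := fun h => succ_sum_fib_notMem_lowerWythoff h2 hS (h ▸ hk) hL
    have := h2 k hk
    omega
  · rintro ⟨S, h3, hS, rfl⟩
    exact succ_sum_fib_mem_lowerWythoff h3 hS
end

section
/- The sumset L + L equals ℕ \ {0, 1, 3}; that is, a natural number n can be written as n = ⌊i·φ⌋ + ⌊j·φ⌋ with integers i, j ≥ 1 if and only if n ∉ {0, 1, 3}. -/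
theorem phi_gt : 1.6 < phi := by
  have : (2.2 : ℝ) < √5 := Real.lt_sqrt_of_sq_lt (by norm_num)
  unfold phi
  linarith

theorem phi_lt : phi < 1.65 := by
  have : √5 < (2.3 : ℝ) := (Real.sqrt_lt' (by norm_num)).2 (by norm_num)
  unfold phi
  linarith

theorem mem_lowerWythoff_iff {n : ℕ} :
    n ∈ lowerWythoff ↔ ∃ i : ℕ, 1 ≤ i ∧ (n : ℝ) ≤ i * phi ∧ i * phi < n + 1 := by
  have h := phi_gt
  refine exists_congr fun i => and_congr_right fun _ => ?_
  rw [eq_comm, Nat.floor_eq_iff (by positivity)]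

theorem one_mem_lowerWythoff : 1 ∈ lowerWythoff :=
  mem_lowerWythoff_iff.2 ⟨1, le_rfl, by norm_num; linarith [phi_gt],
    by norm_num; linarith [phi_lt]⟩

theorem three_mem_lowerWythoff : 3 ∈ lowerWythoff :=
  mem_lowerWythoff_iff.2 ⟨2, by norm_num, by norm_num; linarith [phi_gt],
    by norm_num; linarith [phi_lt]⟩

theorem four_mem_lowerWythoff : 4 ∈ lowerWythoff :=
  mem_lowerWythoff_iff.2 ⟨3, by norm_num, by norm_num; linarith [phi_gt],
    by norm_num; linarith [phi_lt]⟩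

theorem pos_of_mem_lowerWythoff {n : ℕ} (hn : n ∈ lowerWythoff) : 0 < n := by
  obtain ⟨i, hi, -, h⟩ := mem_lowerWythoff_iff.1 hn
  have hi' : (1 : ℝ) ≤ i := by exact_mod_cast hi
  have : (0 : ℝ) < n := by nlinarith [phi_gt]
  exact_mod_cast this

theorem two_notMem_lowerWythoff : 2 ∉ lowerWythoff := by
  intro h2
  obtain ⟨i, hi, hl, hu⟩ := mem_lowerWythoff_iff.1 h2
  push_cast at hl hu
  obtain rfl | hi : i = 1 ∨ 2 ≤ i := by omega
  · push_cast at hl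
    linarith [phi_lt]
  · have hi' : (2 : ℝ) ≤ i := by exact_mod_cast hi
    nlinarith [phi_gt]

/-- Any `n ≥ 5` exceeds some lower Wythoff number by `1`, `3` or `4`. -/
theorem exists_mem_lowerWythoff_add_eq {n : ℕ} (hn : 5 ≤ n) :
    ∃ a ∈ lowerWythoff, n = 1 + a ∨ n = 3 + a ∨ n = 4 + a := by
  have h₁ := phi_gt
  have h₂ := phi_lt
  have hpos : 0 < phi := by linarith
  have hn' : (5 : ℝ) ≤ n := by exact_mod_cast hn
  obtain ⟨k, hk, hku⟩ : ∃ k : ℕ, (k : ℝ) * phi < n ∧ n ≤ (k + 1) * phi := by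
    obtain ⟨k, hk⟩ : ∃ k, ⌈(n : ℝ) / phi⌉₊ = k + 1 :=
      Nat.exists_eq_succ_of_ne_zero (Nat.ceil_pos.2 (by positivity)).ne'
    obtain ⟨hl, hu⟩ := (Nat.ceil_eq_iff (Nat.succ_ne_zero k)).1 hk
    refine ⟨k, (lt_div_iff₀ hpos).1 (by simpa using hl), ?_⟩
    exact (div_le_iff₀ hpos).1 (by exact_mod_cast hu)
  have hk2 : 2 ≤ k := by
    by_contra! hlt
    have : (k : ℝ) ≤ 1 := by exact_mod_cast Nat.le_of_lt_succ hlt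
    nlinarith
  obtain ⟨j, rfl⟩ := Nat.exists_eq_add_of_le' (show 1 ≤ k by omega)
  obtain ⟨m, rfl⟩ := Nat.exists_eq_add_of_le' (show 4 ≤ n by omega)
  push_cast at hk hku
  by_cases ht₁ : (m : ℝ) + 3 ≤ (j + 1) * phi
  · refine ⟨m + 3, mem_lowerWythoff_iff.2 ⟨j + 1, by omega, ?_, ?_⟩, by omega⟩ <;>
      push_cast <;> linarith
  by_cases ht₂ : (m : ℝ) + 1 ≤ j * phi
  · refine ⟨m + 1, mem_lowerWythoff_iff.2 ⟨j, by omega, ?_, ?_⟩, by omega⟩ <;>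
      push_cast <;> linarith
  · exact ⟨m, mem_lowerWythoff_iff.2 ⟨j, by omega, by linarith, by linarith⟩, by omega⟩

/-- Theorem 3.1(i): `L + L = ℕ \ {0, 1, 3}`. -/
theorem lower_add_lower (n : ℕ) :
    (∃ a ∈ lowerWythoff, ∃ b ∈ lowerWythoff, n = a + b) ↔
      n ∉ ({0, 1, 3} : Set ℕ) := by
  simp only [Set.mem_insert_iff, Set.mem_singleton_iff, not_or]
  constructor
  · rintro ⟨a, ha, b, hb, rfl⟩
    have ha0 := pos_of_mem_lowerWythoff ha
    have hb0 := pos_of_mem_lowerWythoff hb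
    have ha2 : a ≠ 2 := fun h => two_notMem_lowerWythoff (h ▸ ha)
    have hb2 : b ≠ 2 := fun h => two_notMem_lowerWythoff (h ▸ hb)
    omega
  · rintro ⟨h0, h1, h3⟩
    obtain rfl | rfl | hn : n = 2 ∨ n = 4 ∨ 5 ≤ n := by omega
    · exact ⟨1, one_mem_lowerWythoff, 1, one_mem_lowerWythoff, rfl⟩
    · exact ⟨1, one_mem_lowerWythoff, 3, three_mem_lowerWythoff, rfl⟩
    · obtain ⟨a, ha, h | h | h⟩ := exists_mem_lowerWythoff_add_eq hn
      · exact ⟨1, one_mem_lowerWythoff, a, ha, h⟩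
      · exact ⟨3, three_mem_lowerWythoff, a, ha, h⟩
      · exact ⟨4, four_mem_lowerWythoff, a, ha, h⟩
end

section
/- The sumset L₀ + L equals ℕ \ {0}; that is, every natural number n ≥ 1 can be written either as n = ⌊j·φ⌋ for some integer j ≥ 1, or as n = ⌊i·φ⌋ + ⌊j·φ⌋ with integers i, j ≥ 1. -/
theorem phi_eq_goldenRatio : phi = Real.goldenRatio := rfl

theorem zero_notMem_lowerWythoff : 0 ∉ lowerWythoff := by
  rintro ⟨i, hi, h⟩
  have hlt := Nat.floor_eq_zero.1 h.symm
  have hi' : (1 : ℝ) ≤ i := by exact_mod_cast hi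
  rw [phi_eq_goldenRatio] at hlt
  nlinarith [Real.one_lt_goldenRatio]

theorem succ_or_add_two_mem_lowerWythoff {m : ℕ} (hm : m ∈ lowerWythoff) :
    m + 1 ∈ lowerWythoff ∨ m + 2 ∈ lowerWythoff := by
  obtain ⟨i, -, rfl⟩ := hm
  have h1 := Real.one_lt_goldenRatio
  have h2 := Real.goldenRatio_lt_two
  rw [← phi_eq_goldenRatio] at h1 h2
  have hpos : (0 : ℝ) ≤ i * phi := by positivity
  have hlow : ⌊(i : ℝ) * phi⌋₊ + 1 ≤ ⌊((i + 1 : ℕ) : ℝ) * phi⌋₊ := by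
    rw [← Nat.floor_add_one hpos]
    apply Nat.floor_le_floor
    push_cast
    linarith
  have hupp : ⌊((i + 1 : ℕ) : ℝ) * phi⌋₊ ≤ ⌊(i : ℝ) * phi⌋₊ + 2 := by
    rw [← Nat.floor_add_ofNat hpos]
    apply Nat.floor_le_floor
    push_cast
    linarith
  have hmem : ⌊((i + 1 : ℕ) : ℝ) * phi⌋₊ ∈ lowerWythoff := ⟨i + 1, by omega, rfl⟩
  obtain h | h : ⌊((i + 1 : ℕ) : ℝ) * phi⌋₊ = ⌊(i : ℝ) * phi⌋₊ + 1 ∨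
      ⌊((i + 1 : ℕ) : ℝ) * phi⌋₊ = ⌊(i : ℝ) * phi⌋₊ + 2 := by omega
  · exact Or.inl (h ▸ hmem)
  · exact Or.inr (h ▸ hmem)

theorem mem_or_succ_mem_lowerWythoff (n : ℕ) : n ∈ lowerWythoff ∨ n + 1 ∈ lowerWythoff := by
  induction n with
  | zero => exact Or.inr one_mem_lowerWythoff
  | succ n ih => exact ih.elim succ_or_add_two_mem_lowerWythoff Or.inl

/-- Theorem 3.1(ii): `L₀ + L = ℕ \ {0}`. -/
theorem lower0_add_lower (n : ℕ) :
    (∃ a ∈ lowerWythoff ∪ {0}, ∃ b ∈ lowerWythoff, n = a + b) ↔ n ≠ 0 := by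
  constructor
  · rintro ⟨a, -, b, hb, rfl⟩ h
    obtain rfl : b = 0 := by omega
    exact zero_notMem_lowerWythoff hb
  · intro hn
    obtain ⟨k, rfl⟩ := Nat.exists_eq_succ_of_ne_zero hn
    rcases mem_or_succ_mem_lowerWythoff k with h | h
    · exact ⟨k, Or.inl h, 1, one_mem_lowerWythoff, rfl⟩
    · exact ⟨0, Or.inr rfl, k + 1, h, (zero_add _).symm⟩
end

section
/- The sumset L + U + U₀ equals ℕ \ {0, 1, 2, 4}; that is, a natural number n can be written as n = a + b + c with a ∈ L, b ∈ U, and c ∈ U₀ if and only if n ∉ {0, 1, 2, 4}. -/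
theorem phi_sq : phi ^ 2 = phi + 1 := by
  have h : Real.sqrt 5 ^ 2 = 5 := Real.sq_sqrt (by norm_num)
  unfold phi
  linear_combination h / 4

theorem three_halves_lt_phi : 3 / 2 < phi := by
  have h : (2 : ℝ) < Real.sqrt 5 := Real.lt_sqrt_of_sq_lt (by norm_num)
  unfold phi
  linarith

theorem phi_lt_five_thirds : phi < 5 / 3 := by
  have h : Real.sqrt 5 < 7 / 3 := (Real.sqrt_lt' (by norm_num)).2 (by norm_num)
  unfold phi
  linarith

theorem mem_lowerWythoff_of_le_of_lt {n : ℕ} (i : ℕ) (hi : 1 ≤ i) (h₁ : (n : ℝ) ≤ i * phi)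
    (h₂ : (i : ℝ) * phi < n + 1) : n ∈ lowerWythoff :=
  ⟨i, hi, ((Nat.floor_eq_iff (n.cast_nonneg.trans h₁)).2 ⟨h₁, h₂⟩).symm⟩

theorem mem_upperWythoff_of_le_of_lt {n : ℕ} (i : ℕ) (hi : 1 ≤ i) (h₁ : (n : ℝ) ≤ i * phi ^ 2)
    (h₂ : (i : ℝ) * phi ^ 2 < n + 1) : n ∈ upperWythoff :=
  ⟨i, hi, ((Nat.floor_eq_iff (n.cast_nonneg.trans h₁)).2 ⟨h₁, h₂⟩).symm⟩

theorem eq_one_or_three_le_of_mem_lowerWythoff {n : ℕ} (hn : n ∈ lowerWythoff) :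
    n = 1 ∨ 3 ≤ n := by
  obtain ⟨i, hi, rfl⟩ := hn
  have hl := three_halves_lt_phi
  have hu := phi_lt_five_thirds
  obtain rfl | hi := hi.eq_or_lt
  · left
    rw [Nat.floor_eq_iff (by push_cast; linarith)]
    constructor <;> push_cast <;> linarith
  · right
    have hi' : (2 : ℝ) ≤ i := by exact_mod_cast hi
    apply Nat.le_floor
    push_cast
    nlinarith

theorem eq_two_or_five_le_of_mem_upperWythoff {n : ℕ} (hn : n ∈ upperWythoff) :
    n = 2 ∨ 5 ≤ n := by
  obtain ⟨i, hi, rfl⟩ := hn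
  have hl := three_halves_lt_phi
  have hu := phi_lt_five_thirds
  rw [phi_sq]
  obtain rfl | hi := hi.eq_or_lt
  · left
    rw [Nat.floor_eq_iff (by push_cast; linarith)]
    constructor <;> push_cast <;> linarith
  · right
    have hi' : (2 : ℝ) ≤ i := by exact_mod_cast hi
    apply Nat.le_floor
    push_cast
    nlinarith

/-- Since `phi < 2`, of two consecutive positive integers at least one is a lower Wythoff number. -/
theorem mem_lowerWythoff_or_succ_mem {m : ℕ} (hm : 1 ≤ m) :
    m ∈ lowerWythoff ∨ m + 1 ∈ lowerWythoff := by
  have hl := three_halves_lt_phi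
  have hu := phi_lt_five_thirds
  have hpos : 0 < phi := by linarith
  have hm' : (0 : ℝ) < m := by exact_mod_cast hm
  have h₁ := (div_le_iff₀ hpos).1 (Nat.le_ceil ((m : ℝ) / phi))
  have h₂ := Nat.ceil_lt_add_one (div_pos hm' hpos).le
  have h₃ : (⌈(m : ℝ) / phi⌉₊ : ℝ) * phi < m + phi := by
    calc _ < ((m : ℝ) / phi + 1) * phi := mul_lt_mul_of_pos_right h₂ hpos
      _ = m + phi := by field_simp
  have hi : 1 ≤ ⌈(m : ℝ) / phi⌉₊ := Nat.ceil_pos.2 (div_pos hm' hpos)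
  rcases lt_or_ge ((⌈(m : ℝ) / phi⌉₊ : ℝ) * phi) (m + 1) with h | h
  · exact Or.inl (mem_lowerWythoff_of_le_of_lt _ hi h₁ h)
  · refine Or.inr (mem_lowerWythoff_of_le_of_lt _ hi ?_ ?_) <;> push_cast <;> linarith

/-- Theorem 3.7(iii): `L + U + U₀ = ℕ \ {0, 1, 2, 4}`. -/
theorem lower_add_upper_add_upper0 (n : ℕ) :
    (∃ a ∈ lowerWythoff, ∃ b ∈ upperWythoff, ∃ c ∈ upperWythoff ∪ {0}, n = a + b + c) ↔
      n ∉ ({0, 1, 2, 4} : Set ℕ) := by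
  have hl := three_halves_lt_phi
  have hu := phi_lt_five_thirds
  simp only [Set.mem_insert_iff, Set.mem_singleton_iff]
  constructor
  · rintro ⟨a, ha, b, hb, c, hc, rfl⟩
    have ha' := eq_one_or_three_le_of_mem_lowerWythoff ha
    have hb' := eq_two_or_five_le_of_mem_upperWythoff hb
    have hc' : c = 0 ∨ 2 ≤ c := by
      rcases hc with hc | hc
      · have := eq_two_or_five_le_of_mem_upperWythoff hc
        omega
      · exact Or.inl hc
    omega
  · intro hn
    have h1 : 1 ∈ lowerWythoff := by
      apply mem_lowerWythoff_of_le_of_lt 1 le_rfl <;> push_cast <;> linarith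
    have h3 : 3 ∈ lowerWythoff := by
      apply mem_lowerWythoff_of_le_of_lt 2 one_le_two <;> push_cast <;> linarith
    have h2 : 2 ∈ upperWythoff := by
      apply mem_upperWythoff_of_le_of_lt 1 le_rfl <;> rw [phi_sq] <;> push_cast <;> linarith
    have h5 : 5 ∈ upperWythoff := by
      apply mem_upperWythoff_of_le_of_lt 2 one_le_two <;> rw [phi_sq] <;> push_cast <;> linarith
    have h0 : 0 ∈ upperWythoff ∪ {0} := Or.inr rfl
    rcases (by omega : n = 3 ∨ n = 5 ∨ 6 ≤ n) with rfl | rfl | h6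
    · exact ⟨1, h1, 2, h2, 0, h0, rfl⟩
    · exact ⟨3, h3, 2, h2, 0, h0, rfl⟩
    · rcases mem_lowerWythoff_or_succ_mem (m := n - 5) (by omega) with h | h
      · exact ⟨_, h, 5, h5, 0, h0, by omega⟩
      · exact ⟨_, h, 2, h2, 2, Or.inl h2, by omega⟩
end

section
/- Every natural number n with n ∉ {0, 1, 2, 3, 4, 5, 6, 8, 10, 12, 19} can be written as n = a + b + c with a ∈ A, b ∈ B, and c ∈ C; moreover no element of {0, 1, 2, 3, 4, 5, 6, 8, 10, 12, 19} is so expressible. -/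
/-- The Tribonacci numbers: `T_0 = 0`, `T_1 = 1`, `T_2 = 1`,
`T_{n+3} = T_{n+2} + T_{n+1} + T_n`. -/
def trib : ℕ → ℕ
  | 0 => 0
  | 1 => 1
  | 2 => 1
  | n + 3 => trib (n + 2) + trib (n + 1) + trib n

/-- `S` is a Tribonacci representation of `m`: a finite set of indices, each at
least 2, with no three consecutive indices, summing to `m`. -/
def IsTribRep (m : ℕ) (S : Finset ℕ) : Prop :=
  (∀ k ∈ S, 2 ≤ k) ∧ (∀ k, ¬(k ∈ S ∧ k + 1 ∈ S ∧ k + 2 ∈ S)) ∧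
    m = ∑ k ∈ S, trib k

/-- The first Carlitz–Scoville–Hoggatt sequence: the Tribonacci representation
of `n - 1` ends in digit 0. -/
def cshA : Set ℕ := {n | 1 ≤ n ∧ ∃ S : Finset ℕ, IsTribRep (n - 1) S ∧ 2 ∉ S}

/-- The second Carlitz–Scoville–Hoggatt sequence: the Tribonacci representation
of `n - 1` ends in digits 01. -/
def cshB : Set ℕ := {n | 1 ≤ n ∧ ∃ S : Finset ℕ, IsTribRep (n - 1) S ∧ 2 ∈ S ∧ 3 ∉ S}

/-- The third Carlitz–Scoville–Hoggatt sequence: the Tribonacci representation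
of `n - 1` ends in digits 011. -/
def cshC : Set ℕ := {n | 1 ≤ n ∧ ∃ S : Finset ℕ, IsTribRep (n - 1) S ∧ 2 ∈ S ∧ 3 ∈ S}

theorem trib_add_three (n : ℕ) : trib (n + 3) = trib (n + 2) + trib (n + 1) + trib n := rfl

theorem trib_le_succ : ∀ n, trib n ≤ trib (n + 1)
  | 0 => by decide
  | 1 => by decide
  | n + 2 => by rw [trib_add_three]; omega

theorem trib_mono : Monotone trib := monotone_nat_of_le_succ trib_le_succ

theorem trib_pos {n : ℕ} (hn : 1 ≤ n) : 1 ≤ trib n := trib_mono hn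

theorem lt_trib_add_two (m : ℕ) : m < trib (m + 2) := by
  induction m with
  | zero => decide
  | succ m ih =>
    have h := trib_add_three m
    have h1 : 1 ≤ trib (m + 1) := trib_pos (by omega)
    change m + 1 < trib (m + 3)
    omega

/-- Every natural number below `trib (N + 2)` has a Tribonacci representation with indices
below `N + 2`. -/
theorem exists_isTribRep_of_lt (N : ℕ) :
    ∀ m < trib (N + 2), ∃ S : Finset ℕ, IsTribRep m S ∧ ∀ k ∈ S, k < N + 2 := by
  induction N with
  | zero =>
    intro m hm
    have h0 : m = 0 := Nat.lt_one_iff.mp hm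
    exact ⟨∅, ⟨by simp, by simp, by simp [h0]⟩, by simp⟩
  | succ N ih =>
    intro m hm
    by_cases hlt : m < trib (N + 2)
    · obtain ⟨S, hS, hb⟩ := ih m hlt
      exact ⟨S, hS, fun k hk => (hb k hk).trans (by omega)⟩
    have hm' : m < trib (N + 2) + trib (N + 1) + trib N := hm
    have hle : trib (N + 1) + trib N ≤ trib (N + 2) := by
      cases N with
      | zero => decide
      | succ N => exact Nat.le_add_right _ (trib N)
    obtain ⟨S, ⟨h2, h3, hsum⟩, hb⟩ := ih (m - trib (N + 2)) (by omega)
    have htop : ¬(N ∈ S ∧ N + 1 ∈ S) := by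
      rintro ⟨hN, hN1⟩
      have hsub : ({N, N + 1} : Finset ℕ) ⊆ S := by
        intro x hx
        simp only [Finset.mem_insert, Finset.mem_singleton] at hx
        rcases hx with rfl | rfl <;> assumption
      have hpair := Finset.sum_le_sum_of_subset (f := trib) hsub
      rw [Finset.sum_pair (by omega)] at hpair
      omega
    have hnot : N + 2 ∉ S := fun h => (hb _ h).false
    refine ⟨insert (N + 2) S, ⟨?_, ?_, ?_⟩, ?_⟩
    · intro k hk
      rcases Finset.mem_insert.mp hk with rfl | hk
      · omega
      · exact h2 k hk
    · rintro k ⟨hk, hk1, hk2⟩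
      simp only [Finset.mem_insert] at hk hk1 hk2
      rcases hk2 with hk2 | hk2
      · obtain rfl : k = N := by omega
        exact htop ⟨hk.resolve_left (by omega), hk1.resolve_left (by omega)⟩
      · have := hb _ hk2
        exact h3 k ⟨hk.resolve_left (by omega), hk1.resolve_left (by omega), hk2⟩
    · rw [Finset.sum_insert hnot]
      omega
    · intro k hk
      rcases Finset.mem_insert.mp hk with rfl | hk
      · omega
      · exact (hb k hk).trans (by omega)

theorem exists_isTribRep (m : ℕ) : ∃ S : Finset ℕ, IsTribRep m S :=
  let ⟨S, hS, _⟩ := exists_isTribRep_of_lt m m (lt_trib_add_two m)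
  ⟨S, hS⟩

/-- Among two consecutive positive integers, at least one lies in `cshA`. -/
theorem mem_cshA_or_succ_mem_cshA {n : ℕ} (hn : 1 ≤ n) : n ∈ cshA ∨ n + 1 ∈ cshA := by
  obtain ⟨S, hS⟩ := exists_isTribRep n
  by_cases h : 2 ∈ S
  · refine Or.inl ⟨hn, S.erase 2, ⟨fun k hk => hS.1 k (Finset.mem_of_mem_erase hk), ?_, ?_⟩,
      by simp⟩
    · rintro k ⟨h0, h1, h2⟩
      exact hS.2.1 k ⟨Finset.mem_of_mem_erase h0, Finset.mem_of_mem_erase h1,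
        Finset.mem_of_mem_erase h2⟩
    · have hsum := hS.2.2
      rw [← Finset.add_sum_erase S trib h] at hsum
      have h2 : trib 2 = 1 := rfl
      omega
  · exact Or.inr ⟨by omega, S, hS, h⟩

/-- Representations of numbers below `trib 7 = 24` only use the indices from 2 to 6. -/
theorem isTribRep_iff_of_lt {m : ℕ} (hm : m < 24) (S : Finset ℕ) :
    IsTribRep m S ↔ S ∈ (Finset.Icc 2 6).powerset ∧
      (∀ k ∈ S, ¬(k + 1 ∈ S ∧ k + 2 ∈ S)) ∧ m = ∑ k ∈ S, trib k := by
  constructor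
  · rintro ⟨h2, h3, hsum⟩
    refine ⟨Finset.mem_powerset.mpr fun k hk => Finset.mem_Icc.mpr ⟨h2 k hk, ?_⟩,
      fun k hk h => h3 k ⟨hk, h⟩, hsum⟩
    by_contra! hk7
    have h7 : trib 7 ≤ trib k := trib_mono hk7
    have hk' : trib k ≤ ∑ k ∈ S, trib k :=
      Finset.single_le_sum (fun _ _ => Nat.zero_le _) hk
    have : trib 7 = 24 := by decide
    omega
  · rintro ⟨hS, h3, hsum⟩
    exact ⟨fun k hk => (Finset.mem_Icc.mp (Finset.mem_powerset.mp hS hk)).1,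
      fun k h => h3 k h.1 h.2, hsum⟩

theorem exists_isTribRep_and_iff_of_lt {m : ℕ} (hm : m < 24) (P : Finset ℕ → Prop) :
    (∃ S, IsTribRep m S ∧ P S) ↔ ∃ S ∈ (Finset.Icc 2 6).powerset,
      ((∀ k ∈ S, ¬(k + 1 ∈ S ∧ k + 2 ∈ S)) ∧ m = ∑ k ∈ S, trib k) ∧ P S := by
  simp only [isTribRep_iff_of_lt hm, and_assoc]

theorem mem_cshA_iff_of_lt {n : ℕ} (hn : n < 22) :
    n ∈ cshA ↔ n ∈ ({1, 3, 5, 7, 8, 10, 12, 14, 16, 18, 20, 21} : Finset ℕ) := by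
  rw [cshA, Set.mem_ofPred_eq, exists_isTribRep_and_iff_of_lt (by omega)]
  revert n
  decide +kernel

theorem mem_cshB_iff_of_lt {n : ℕ} (hn : n < 22) :
    n ∈ cshB ↔ n ∈ ({2, 6, 9, 13, 15, 19} : Finset ℕ) := by
  rw [cshB, Set.mem_ofPred_eq, exists_isTribRep_and_iff_of_lt (by omega)]
  revert n
  decide +kernel

theorem mem_cshC_iff_of_lt {n : ℕ} (hn : n < 22) :
    n ∈ cshC ↔ n ∈ ({4, 11, 17} : Finset ℕ) := by
  rw [cshC, Set.mem_ofPred_eq, exists_isTribRep_and_iff_of_lt (by omega)]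
  revert n
  decide +kernel

theorem A_add_B_add_C_of_lt {n : ℕ} (hn : n < 22) :
    (∃ a ∈ cshA, ∃ b ∈ cshB, ∃ c ∈ cshC, n = a + b + c) ↔
      n ∉ ({0, 1, 2, 3, 4, 5, 6, 8, 10, 12, 19} : Finset ℕ) := by
  trans ∃ a < 22, ∃ b < 22, ∃ c ∈ ({4, 11, 17} : Finset ℕ),
    a ∈ ({1, 3, 5, 7, 8, 10, 12, 14, 16, 18, 20, 21} : Finset ℕ) ∧
      b ∈ ({2, 6, 9, 13, 15, 19} : Finset ℕ) ∧ n = a + b + c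
  · constructor
    · rintro ⟨a, ha, b, hb, c, hc, h⟩
      exact ⟨a, by omega, b, by omega, c, (mem_cshC_iff_of_lt (by omega)).mp hc,
        (mem_cshA_iff_of_lt (by omega)).mp ha, (mem_cshB_iff_of_lt (by omega)).mp hb, h⟩
    · rintro ⟨a, ha', b, hb', c, hc, ha, hb, h⟩
      exact ⟨a, (mem_cshA_iff_of_lt ha').mpr ha, b, (mem_cshB_iff_of_lt hb').mpr hb,
        c, (mem_cshC_iff_of_lt (by omega)).mpr hc, h⟩
  · revert n
    decide +kernel

/-- Every natural number outside `{0,1,2,3,4,5,6,8,10,12,19}` is a sum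
`a + b + c` with `a ∈ A`, `b ∈ B`, `c ∈ C`, and no number in that set is. -/
theorem A_add_B_add_C (n : ℕ) :
    (∃ a ∈ cshA, ∃ b ∈ cshB, ∃ c ∈ cshC, n = a + b + c) ↔
      n ∉ ({0, 1, 2, 3, 4, 5, 6, 8, 10, 12, 19} : Set ℕ) := by
  rcases lt_or_ge n 22 with hn | hn
  · simpa using A_add_B_add_C_of_lt hn
  refine iff_of_true ?_ (by simp only [Set.mem_insert_iff, Set.mem_singleton_iff]; omega)
  rcases mem_cshA_or_succ_mem_cshA (n := n - 20) (by omega) with h | h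
  · exact ⟨_, h, 9, (mem_cshB_iff_of_lt (by omega)).mpr (by decide),
      11, (mem_cshC_iff_of_lt (by omega)).mpr (by decide), by omega⟩
  · exact ⟨_, h, 15, (mem_cshB_iff_of_lt (by omega)).mpr (by decide),
      4, (mem_cshC_iff_of_lt (by omega)).mpr (by decide), by omega⟩
end
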